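/- Suppose c₂ > 0, 2c₃ − c₂ > 0, and 2c₂ + c₄ = 0. Then the minimum of f_s(Q, ν) over Q ∈ 𝒜 is attained, and every minimizer Q satisfies Qν·ν = c₁/(c₂ − 2c₃) and has an eigenvector orthogonal to ν with eigenvalue c₁/(4c₃ − 2c₂). -/

import Mathlib

open Matrix

/-- The surface energy `f_s(Q, ν) = c₁ (Qν·ν) + c₂ (Q·Q) + c₃ (Qν·ν)² + c₄ |Qν|²`,
where `A·B = tr(BᵀA)`. -/
noncomputable def surfE (c₁ c₂ c₃ c₄ : ℝ) (Q : Matrix (Fin 3) (Fin 3) ℝ)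
    (ν : Fin 3 → ℝ) : ℝ :=
  c₁ * (Q.mulVec ν ⬝ᵥ ν) + c₂ * (Qᵀ * Q).trace
    + c₃ * (Q.mulVec ν ⬝ᵥ ν) ^ 2 + c₄ * (Q.mulVec ν ⬝ᵥ Q.mulVec ν)

/-- The set `𝒜` of real symmetric traceless 3×3 matrices. -/
def inA (Q : Matrix (Fin 3) (Fin 3) ℝ) : Prop := Q.IsSymm ∧ Q.trace = 0

/-- The tangential part of `Q` with respect to `ν`, shifted by half of `Qν·ν` times the projection
onto the orthogonal complement of `ν`. -/
noncomputable def tangentialDefect (Q : Matrix (Fin 3) (Fin 3) ℝ) (ν : Fin 3 → ℝ) :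
    Matrix (Fin 3) (Fin 3) ℝ :=
  Q - vecMulVec ν (Q.mulVec ν) - vecMulVec (Q.mulVec ν) ν
    + ((Q.mulVec ν ⬝ᵥ ν) / 2) • (vecMulVec ν ν + 1)

lemma trace_tangentialDefect_sq {Q : Matrix (Fin 3) (Fin 3) ℝ} (hQ : inA Q) {ν : Fin 3 → ℝ}
    (hν : ν ⬝ᵥ ν = 1) :
    ((tangentialDefect Q ν)ᵀ * tangentialDefect Q ν).trace =
      (Qᵀ * Q).trace - 2 * (Q.mulVec ν ⬝ᵥ Q.mulVec ν) + (Q.mulVec ν ⬝ᵥ ν) ^ 2 / 2 := by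
  obtain ⟨hs, ht⟩ := hQ
  have hw : ν ᵥ* Q = Q *ᵥ ν := by rw [← mulVec_transpose, hs.eq]
  have hR : (tangentialDefect Q ν)ᵀ = tangentialDefect Q ν := by
    simp [tangentialDefect, hs.eq, transpose_vecMulVec]
    abel
  have hwc : ν ⬝ᵥ Q *ᵥ ν = Q *ᵥ ν ⬝ᵥ ν := dotProduct_comm _ _
  have hq : Q *ᵥ Q *ᵥ ν ⬝ᵥ ν = Q *ᵥ ν ⬝ᵥ Q *ᵥ ν := by
    rw [dotProduct_comm, dotProduct_mulVec, hw]
  have hq' : ν ⬝ᵥ (Q *ᵥ ν) ᵥ* Q = Q *ᵥ ν ⬝ᵥ Q *ᵥ ν := by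
    rw [← mulVec_transpose, hs.eq, dotProduct_comm, hq]
  rw [hR, hs.eq]
  generalize hwd : Q *ᵥ ν = w at *
  simp only [tangentialDefect, hwd, mul_add, add_mul, mul_sub, sub_mul, Matrix.mul_smul,
    Matrix.smul_mul, mul_vecMulVec, vecMulVec_mul, hw, Matrix.mul_one, Matrix.one_mul, trace_add, trace_sub,
    trace_smul, trace_vecMulVec, vecMulVec_mulVec, smul_dotProduct, smul_mulVec, one_mulVec, hν, hwc,
    hq, hq', ht, trace_one, smul_eq_mul, smul_add, MulOpposite.smul_eq_mul_unop, MulOpposite.unop_op,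
    Fintype.card_fin]
  ring

lemma surfE_eq {c₁ c₂ c₃ c₄ : ℝ} (h24 : 2 * c₂ + c₄ = 0) (h32 : 0 < 2 * c₃ - c₂)
    {Q : Matrix (Fin 3) (Fin 3) ℝ} (hQ : inA Q) {ν : Fin 3 → ℝ} (hν : ν ⬝ᵥ ν = 1) :
    surfE c₁ c₂ c₃ c₄ Q ν =
      (2 * c₃ - c₂) / 2 * (Q.mulVec ν ⬝ᵥ ν - c₁ / (c₂ - 2 * c₃)) ^ 2
        + c₂ * ((tangentialDefect Q ν)ᵀ * tangentialDefect Q ν).trace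
        - c₁ ^ 2 / (2 * (2 * c₃ - c₂)) := by
  rw [trace_tangentialDefect_sq hQ hν, surfE]
  obtain rfl : c₄ = -2 * c₂ := by linarith
  obtain ⟨d, hd⟩ : ∃ d, 2 * c₃ - c₂ = d := ⟨_, rfl⟩
  obtain rfl : c₃ = (d + c₂) / 2 := by linarith
  rw [hd] at h32 ⊢
  rw [← neg_sub (2 * ((d + c₂) / 2)) c₂, hd]
  field_simp
  ring

lemma trace_transpose_mul_self_nonneg (R : Matrix (Fin 3) (Fin 3) ℝ) : 0 ≤ (Rᵀ * R).trace := by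
  simpa using (posSemidef_conjTranspose_mul_self R).trace_nonneg

/-- The uniaxial tensor with director `ν` and eigenvalue `a` in the direction `ν`. -/
noncomputable def uniaxial (a : ℝ) (ν : Fin 3 → ℝ) : Matrix (Fin 3) (Fin 3) ℝ :=
  (3 * a / 2) • vecMulVec ν ν - (a / 2) • 1

lemma inA_uniaxial (a : ℝ) {ν : Fin 3 → ℝ} (hν : ν ⬝ᵥ ν = 1) : inA (uniaxial a ν) := by
  constructor
  · simp [uniaxial, IsSymm, transpose_vecMulVec]
  · simp [uniaxial, trace_vecMulVec, hν]
    ring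

lemma uniaxial_mulVec (a : ℝ) {ν : Fin 3 → ℝ} (hν : ν ⬝ᵥ ν = 1) :
    (uniaxial a ν).mulVec ν = a • ν := by
  ext i
  simp [uniaxial, sub_mulVec, smul_mulVec, vecMulVec_mulVec, hν]
  ring

lemma tangentialDefect_uniaxial (a : ℝ) {ν : Fin 3 → ℝ} (hν : ν ⬝ᵥ ν = 1) :
    tangentialDefect (uniaxial a ν) ν = 0 := by
  rw [tangentialDefect, uniaxial_mulVec a hν, smul_dotProduct, hν, uniaxial, vecMulVec_smul,
    smul_vecMulVec]
  module

lemma surfE_uniaxial {c₁ c₂ c₃ c₄ : ℝ} (h24 : 2 * c₂ + c₄ = 0) (h32 : 0 < 2 * c₃ - c₂)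
    {ν : Fin 3 → ℝ} (hν : ν ⬝ᵥ ν = 1) :
    surfE c₁ c₂ c₃ c₄ (uniaxial (c₁ / (c₂ - 2 * c₃)) ν) ν =
      - (c₁ ^ 2 / (2 * (2 * c₃ - c₂))) := by
  rw [surfE_eq h24 h32 (inA_uniaxial _ hν) hν, tangentialDefect_uniaxial _ hν,
    uniaxial_mulVec _ hν, smul_dotProduct, hν]
  simp

lemma exists_ne_zero_orthogonal (x y : Fin 3 → ℝ) :
    ∃ v : Fin 3 → ℝ, v ≠ 0 ∧ v ⬝ᵥ x = 0 ∧ v ⬝ᵥ y = 0 := by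
  obtain ⟨v, hv, h⟩ := exists_mulVec_eq_zero_iff.2
    (det_zero_of_row_eq (M := of ![x, y, y]) (i := 1) (j := 2) (by decide) rfl)
  refine ⟨v, hv, ?_, ?_⟩
  · rw [dotProduct_comm]; exact congrFun h 0
  · rw [dotProduct_comm]; exact congrFun h 1

lemma mulVec_of_tangentialDefect_eq_zero {Q : Matrix (Fin 3) (Fin 3) ℝ} {ν v : Fin 3 → ℝ}
    (h : tangentialDefect Q ν = 0) (hv : v ⬝ᵥ ν = 0) (hw : v ⬝ᵥ Q.mulVec ν = 0) :
    Q.mulVec v = (-((Q.mulVec ν ⬝ᵥ ν) / 2)) • v := by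
  have h' := congrArg (· *ᵥ v) h
  rw [dotProduct_comm] at hv hw
  simp only [tangentialDefect, add_mulVec, sub_mulVec, smul_mulVec, vecMulVec_mulVec, hv, hw,
    one_mulVec, zero_mulVec, MulOpposite.op_zero, zero_smul, sub_zero, zero_add] at h'
  rw [neg_smul]
  exact eq_neg_of_add_eq_zero_left h'

theorem surface_min_case_iii (c₁ c₂ c₃ c₄ : ℝ) (ν : Fin 3 → ℝ) (hν : ν ⬝ᵥ ν = 1)
    (h2 : 0 < c₂) (h32 : 0 < 2 * c₃ - c₂) (h24 : 2 * c₂ + c₄ = 0) :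
    (∃ Q₀, inA Q₀ ∧ ∀ Q, inA Q → surfE c₁ c₂ c₃ c₄ Q₀ ν ≤ surfE c₁ c₂ c₃ c₄ Q ν) ∧
    (∀ Q, inA Q → (∀ Q', inA Q' → surfE c₁ c₂ c₃ c₄ Q ν ≤ surfE c₁ c₂ c₃ c₄ Q' ν) →
      Q.mulVec ν ⬝ᵥ ν = c₁ / (c₂ - 2 * c₃) ∧
      ∃ v : Fin 3 → ℝ, v ≠ 0 ∧ v ⬝ᵥ ν = 0 ∧
        Q.mulVec v = (c₁ / (4 * c₃ - 2 * c₂)) • v) := by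
  have hmin (Q) (hQ : inA Q) := surfE_eq (c₁ := c₁) h24 h32 hQ hν
  have hQ₀ := surfE_uniaxial (c₁ := c₁) h24 h32 hν
  refine ⟨⟨uniaxial (c₁ / (c₂ - 2 * c₃)) ν, inA_uniaxial _ hν, fun Q hQ ↦ ?_⟩, fun Q hQ hle ↦ ?_⟩
  · rw [hQ₀, hmin Q hQ]
    have := mul_nonneg h2.le (trace_transpose_mul_self_nonneg (tangentialDefect Q ν))
    have := mul_nonneg (half_pos h32).le (sq_nonneg (Q.mulVec ν ⬝ᵥ ν - c₁ / (c₂ - 2 * c₃)))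
    linarith
  · have hle := hle _ (inA_uniaxial (c₁ / (c₂ - 2 * c₃)) hν)
    rw [hQ₀, hmin Q hQ] at hle
    have hR := mul_nonneg h2.le (trace_transpose_mul_self_nonneg (tangentialDefect Q ν))
    have hS := mul_nonneg (half_pos h32).le (sq_nonneg (Q.mulVec ν ⬝ᵥ ν - c₁ / (c₂ - 2 * c₃)))
    have hR0 : ((tangentialDefect Q ν)ᵀ * tangentialDefect Q ν).trace = 0 :=
      (mul_eq_zero.1 (by linarith)).resolve_left h2.ne'
    have hS0 : (2 * c₃ - c₂) / 2 * (Q.mulVec ν ⬝ᵥ ν - c₁ / (c₂ - 2 * c₃)) ^ 2 = 0 := by linarith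
    have ha : Q.mulVec ν ⬝ᵥ ν = c₁ / (c₂ - 2 * c₃) :=
      sub_eq_zero.1 (pow_eq_zero_iff two_ne_zero |>.1
        ((mul_eq_zero.1 hS0).resolve_left (half_pos h32).ne'))
    refine ⟨ha, ?_⟩
    obtain ⟨v, hv, hvν, hvw⟩ := exists_ne_zero_orthogonal ν (Q.mulVec ν)
    refine ⟨v, hv, hvν, ?_⟩
    have hzero : tangentialDefect Q ν = 0 :=
      trace_conjTranspose_mul_self_eq_zero_iff.1 (by simpa using hR0)
    rw [mulVec_of_tangentialDefect_eq_zero hzero hvν hvw, ha]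
    congr 1
    rw [div_div, ← div_neg]
    congr 1
    ring
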